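/- (Theorem 3.3(iii).) Set m = min{k : a_k > 0}, suppose p ≤ t, and let x₀ = (∑_{k=m}^{p−1} α_k (k−1)/k) / (∑_{k=m}^p α_k (k−1)(k − 1 − 1/t)/k). If 1/(p−1) < x₀ < 1/(p−2), then x* = x₀, y* = ∑_{k=m}^p α_k (k−1)(1 − 1/k − 1/(kt)) x₀² − 2 ∑_{k=m}^{p−1} α_k (1 − 1/k) x₀ + ∑_{k=m}^p α_k (k−1) − 2α_p/p, and T = ⟨re⟩. -/

import Mathlib

open Matrix Finset

noncomputable section

/-- `B^m_{i,j}`: the `i × j` real matrix whose upper-left `m × m` block is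
`B_m = I_m − J_m/m` and whose remaining entries are `0`. -/
def Bblock (m i j : ℕ) : Matrix (Fin i) (Fin j) ℝ :=
  Matrix.of fun a b =>
    if (a : ℕ) < m ∧ (b : ℕ) < m then
      (if (a : ℕ) = (b : ℕ) then 1 else 0) - 1 / (m : ℝ)
    else 0

/-- `B_k = I_k − J_k/k`. -/
def Bsq (k : ℕ) : Matrix (Fin k) (Fin k) ℝ := Bblock k k k

/-- Partial sums `a_{j,k} = ∑_{i=j}^k a_i`. -/
def aInt (a : ℕ → ℝ) (j k : ℕ) : ℝ := ∑ i ∈ Finset.Icc j k, a i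

/-- `α_k = n⁻¹((n+1)a_k + a_{1,k−1}^{n+1} − a_{1,k}^{n+1})`. -/
def alphaCoef (n : ℕ) (a : ℕ → ℝ) (k : ℕ) : ℝ :=
  (((n : ℝ) + 1) * a k + (aInt a 1 (k - 1)) ^ (n + 1) - (aInt a 1 k) ^ (n + 1)) / (n : ℝ)

/-- `β_k = a_k + a_{k+1,p} a_{1,k}^n − a_{k,p} a_{1,k−1}^n`. -/
def betaCoef (p n : ℕ) (a : ℕ → ℝ) (k : ℕ) : ℝ :=
  a k + aInt a (k + 1) p * (aInt a 1 k) ^ n - aInt a k p * (aInt a 1 (k - 1)) ^ n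

/-- `A = ∑_{k=1}^p α_k B^k_p`. -/
def Amat (p n : ℕ) (a : ℕ → ℝ) : Matrix (Fin p) (Fin p) ℝ :=
  ∑ k ∈ Finset.Icc 1 p, alphaCoef n a k • Bblock k p p

/-- `B = ∑_{k=1}^p β_k B^k_p`. -/
def Bmat (p n : ℕ) (a : ℕ → ℝ) : Matrix (Fin p) (Fin p) ℝ :=
  ∑ k ∈ Finset.Icc 1 p, betaCoef p n a k • Bblock k p p


/-- Treatment/period incidence matrix `T_s` of a treatment sequence `s`
(periods are indexed by `Fin p`, treatments by `Fin t`). -/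
def Tmat {p t : ℕ} (s : Fin p → Fin t) : Matrix (Fin p) (Fin t) ℝ :=
  Matrix.of fun k i => if s k = i then 1 else 0

/-- Carryover incidence matrix `F_s`: `(F_s)_{k,i} = 1` iff `k ≥ 2` and the
treatment in period `k − 1` is `i`. -/
def Fmat {p t : ℕ} (s : Fin p → Fin t) : Matrix (Fin p) (Fin t) ℝ :=
  Matrix.of fun k i =>
    if (k : ℕ) = 0 then 0
    else if s ⟨(k : ℕ) - 1, lt_of_le_of_lt (Nat.sub_le _ _) k.isLt⟩ = i then 1 else 0

/-- `T̂_s = T_s B_t`. -/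
def That {p t : ℕ} (s : Fin p → Fin t) : Matrix (Fin p) (Fin t) ℝ := Tmat s * Bsq t

/-- `F̂_s = F_s B_t`. -/
def Fhat {p t : ℕ} (s : Fin p → Fin t) : Matrix (Fin p) (Fin t) ℝ := Fmat s * Bsq t

/-- An approximate design: a probability vector indexed by all `t^p` sequences. -/
def IsDesign {p t : ℕ} (P : (Fin p → Fin t) → ℝ) : Prop :=
  (∀ s, 0 ≤ P s) ∧ ∑ s, P s = 1

/-- A design is symmetric if it is invariant under relabeling of treatments. -/
def IsSymmetricDesign {p t : ℕ} (P : (Fin p → Fin t) → ℝ) : Prop :=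
  ∀ (σ : Equiv.Perm (Fin t)) (s : Fin p → Fin t), P (fun k => σ (s k)) = P s

/-- `T̄ = ∑_s p_s T_s`. -/
def Tbar {p t : ℕ} (P : (Fin p → Fin t) → ℝ) : Matrix (Fin p) (Fin t) ℝ :=
  ∑ s, P s • Tmat s

/-- `F̄ = ∑_s p_s F_s`. -/
def Fbar {p t : ℕ} (P : (Fin p → Fin t) → ℝ) : Matrix (Fin p) (Fin t) ℝ :=
  ∑ s, P s • Fmat s

/-- `C₁₁(P) = n(∑_s p_s T_s' A T_s − T̄' B T̄)`. -/
def C11 (p t n : ℕ) (a : ℕ → ℝ) (P : (Fin p → Fin t) → ℝ) : Matrix (Fin t) (Fin t) ℝ :=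
  (n : ℝ) • (∑ s, P s • ((Tmat s)ᵀ * Amat p n a * Tmat s) - (Tbar P)ᵀ * Bmat p n a * Tbar P)

/-- `C₁₂(P) = n(∑_s p_s T_s' A F_s − T̄' B F̄)`. -/
def C12 (p t n : ℕ) (a : ℕ → ℝ) (P : (Fin p → Fin t) → ℝ) : Matrix (Fin t) (Fin t) ℝ :=
  (n : ℝ) • (∑ s, P s • ((Tmat s)ᵀ * Amat p n a * Fmat s) - (Tbar P)ᵀ * Bmat p n a * Fbar P)

/-- `C₂₂(P) = n(∑_s p_s F_s' A F_s − F̄' B F̄)`. -/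
def C22 (p t n : ℕ) (a : ℕ → ℝ) (P : (Fin p → Fin t) → ℝ) : Matrix (Fin t) (Fin t) ℝ :=
  (n : ℝ) • (∑ s, P s • ((Fmat s)ᵀ * Amat p n a * Fmat s) - (Fbar P)ᵀ * Bmat p n a * Fbar P)

/-- `W` is a generalized inverse of `C`. -/
def IsGInv {t : ℕ} (C W : Matrix (Fin t) (Fin t) ℝ) : Prop := C * W * C = C

/-- The information matrix `C(P) = C₁₁(P) − C₁₂(P) W C₂₁(P)`, computed with a
generalized inverse `W` of `C₂₂(P)` (its value does not depend on the choice). -/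
def CInfo (p t n : ℕ) (a : ℕ → ℝ) (P : (Fin p → Fin t) → ℝ)
    (W : Matrix (Fin t) (Fin t) ℝ) : Matrix (Fin t) (Fin t) ℝ :=
  C11 p t n a P - C12 p t n a P * W * (C12 p t n a P)ᵀ

/-- The `t × t` permutation matrix of a permutation `σ` of the treatments. -/
def permMat (t : ℕ) (σ : Equiv.Perm (Fin t)) : Matrix (Fin t) (Fin t) ℝ :=
  Matrix.of fun i j => if σ j = i then 1 else 0

/-- An optimality criterion: a real-valued function `Φ` on `t × t` real symmetric
matrices which is (C.1) concave, (C.2) invariant under simultaneous permutation of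
rows and columns, and (C.3) nondecreasing under positive scaling of a positive
semidefinite matrix. -/
def IsCriterion (t : ℕ) (Φ : Matrix (Fin t) (Fin t) ℝ → ℝ) : Prop :=
  (∀ lam : ℝ, 0 ≤ lam → lam ≤ 1 → ∀ M N : Matrix (Fin t) (Fin t) ℝ,
      M.IsHermitian → N.IsHermitian →
      lam * Φ M + (1 - lam) * Φ N ≤ Φ (lam • M + (1 - lam) • N)) ∧
  (∀ (σ : Equiv.Perm (Fin t)) (M : Matrix (Fin t) (Fin t) ℝ),
      Φ ((permMat t σ)ᵀ * M * permMat t σ) = Φ M) ∧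
  (∀ M : Matrix (Fin t) (Fin t) ℝ, M.PosSemidef →
      ∀ b c : ℝ, 0 < b → b ≤ c → Φ (b • M) ≤ Φ (c • M))

/-- `P` is φ₁-universally optimal: `Φ(C(P)) ≥ Φ(C(Q))` for every design `Q` and
every optimality criterion `Φ`. -/
def IsUnivOptimal (p t n : ℕ) (a : ℕ → ℝ) (P : (Fin p → Fin t) → ℝ) : Prop :=
  ∀ Φ : Matrix (Fin t) (Fin t) ℝ → ℝ, IsCriterion t Φ →
    ∀ Q : (Fin p → Fin t) → ℝ, IsDesign Q →
      ∀ WP WQ : Matrix (Fin t) (Fin t) ℝ,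
        IsGInv (C22 p t n a P) WP → IsGInv (C22 p t n a Q) WQ →
          Φ (CInfo p t n a Q WQ) ≤ Φ (CInfo p t n a P WP)

/-- `q_{s,11} = tr(B_t T_s' A T_s B_t)`. -/
def q11 (p t n : ℕ) (a : ℕ → ℝ) (s : Fin p → Fin t) : ℝ :=
  (Bsq t * (Tmat s)ᵀ * Amat p n a * Tmat s * Bsq t).trace

/-- `q_{s,12} = tr(B_t T_s' A F_s B_t)`. -/
def q12 (p t n : ℕ) (a : ℕ → ℝ) (s : Fin p → Fin t) : ℝ :=
  (Bsq t * (Tmat s)ᵀ * Amat p n a * Fmat s * Bsq t).trace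

/-- `q_{s,22} = tr(B_t F_s' A F_s B_t)`. -/
def q22 (p t n : ℕ) (a : ℕ → ℝ) (s : Fin p → Fin t) : ℝ :=
  (Bsq t * (Fmat s)ᵀ * Amat p n a * Fmat s * Bsq t).trace

/-- The quadratic `q_s(x) = q_{s,11} + 2 q_{s,12} x + q_{s,22} x²`. -/
def qfun (p t n : ℕ) (a : ℕ → ℝ) (s : Fin p → Fin t) (x : ℝ) : ℝ :=
  q11 p t n a s + 2 * q12 p t n a s * x + q22 p t n a s * x ^ 2

/-- `min_x ∑_s p_s q_s(x)`. -/
def qmin (p t n : ℕ) (a : ℕ → ℝ) (P : (Fin p → Fin t) → ℝ) : ℝ :=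
  sInf (Set.range fun x : ℝ => ∑ s, P s * qfun p t n a s x)

/-- `y* = max_P min_x ∑_s p_s q_s(x)`, the maximum over all approximate designs. -/
def ystar (p t n : ℕ) (a : ℕ → ℝ) : ℝ :=
  sSup {y : ℝ | ∃ P : (Fin p → Fin t) → ℝ, IsDesign P ∧ y = qmin p t n a P}

/-- `⟨re⟩`: sequences whose first `p − 1` entries are pairwise distinct and whose
last entry repeats the entry in period `p − 1`. -/
def reSet (p t : ℕ) : Set (Fin p → Fin t) :=
  {s | (∀ j j' : Fin p, (j : ℕ) + 1 < p → (j' : ℕ) + 1 < p → s j = s j' → j = j') ∧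
    ∀ (h1 : p - 1 < p) (h2 : p - 2 < p), s ⟨p - 1, h1⟩ = s ⟨p - 2, h2⟩}

theorem Bsq_apply (t : ℕ) (i j : Fin t) :
    Bsq t i j = (if i = j then 1 else 0) - 1 / (t : ℝ) := by
  simp [Bsq, Bblock, Fin.ext_iff]

theorem Bsq_mul_self {t : ℕ} (ht : 0 < t) : Bsq t * Bsq t = Bsq t := by
  have : (t : ℝ) ≠ 0 := by positivity
  ext i j
  simp only [Matrix.mul_apply, Bsq_apply, sub_mul, mul_sub, Finset.sum_sub_distrib]
  simp
  field_simp
  ring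

/-- The inner product of two vectors after centering. -/
def centeredInner {t : ℕ} (u v : Fin t → ℝ) : ℝ :=
  ∑ i, u i * v i - (∑ i, u i) * (∑ i, v i) / t

theorem sum_fin_ite_lt {p k : ℕ} (hk : k ≤ p) (f : ℕ → ℝ) :
    ∑ c : Fin p, (if (c : ℕ) < k then f c else 0) = ∑ c ∈ Finset.range k, f c := by
  rw [Fin.sum_univ_eq_sum_range (fun c => if c < k then f c else 0) p, ← Finset.sum_filter]
  congr 1
  ext c
  simp only [Finset.mem_filter, Finset.mem_range]
  omega

theorem mul_Bsq_mul_transpose_apply {p t : ℕ} (X Y : Matrix (Fin p) (Fin t) ℝ) (c d : Fin p) :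
    (Y * Bsq t * Xᵀ) d c = centeredInner (fun i => X c i) (fun i => Y d i) := by
  simp only [Matrix.mul_apply, Bsq_apply, mul_sub, Finset.sum_sub_distrib, sub_mul,
    Matrix.transpose_apply, centeredInner]
  congr 1
  · simp [mul_comm]
  · rw [← Finset.sum_mul, ← Finset.mul_sum]
    ring

theorem trace_Bblock_form {p t k : ℕ} (ht : 0 < t) (hk : k ≤ p) (u v : ℕ → Fin t → ℝ) :
    (Bsq t * (Matrix.of fun (c : Fin p) i => u c i)ᵀ * Bblock k p p *
      (Matrix.of fun (c : Fin p) i => v c i) * Bsq t).trace =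
    ∑ c ∈ Finset.range k, centeredInner (u c) (v c) -
      (∑ c ∈ Finset.range k, ∑ d ∈ Finset.range k, centeredInner (u c) (v d)) / k := by
  set X : Matrix (Fin p) (Fin t) ℝ := Matrix.of fun c i => u c i with hX
  set Y : Matrix (Fin p) (Fin t) ℝ := Matrix.of fun c i => v c i with hY
  have h1 : (Bsq t * Xᵀ * Bblock k p p * Y * Bsq t).trace =
      (Bblock k p p * (Y * Bsq t * Xᵀ)).trace := by
    rw [Matrix.trace_mul_comm]
    have : Bsq t * (Bsq t * Xᵀ * Bblock k p p * Y) = (Bsq t * Xᵀ) * (Bblock k p p * Y) := by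
      simp only [← Matrix.mul_assoc, Bsq_mul_self ht]
    rw [this, Matrix.trace_mul_comm]
    simp only [Matrix.mul_assoc]
  rw [h1, Matrix.trace]
  simp only [Matrix.diag_apply, Matrix.mul_apply (M := Bblock k p p), mul_Bsq_mul_transpose_apply]
  have h2 : ∀ c : Fin p, ∑ d : Fin p, Bblock k p p c d * centeredInner (fun i => X c i) (fun i => Y d i) =
      if (c : ℕ) < k then centeredInner (u c) (v c) -
        (∑ d ∈ Finset.range k, centeredInner (u c) (v d)) / k else 0 := by
    intro c
    by_cases hc : (c : ℕ) < k
    · rw [if_pos hc, ← sum_fin_ite_lt hk, Finset.sum_div]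
      have : centeredInner (u c) (v c) =
          ∑ d : Fin p, if c = d then centeredInner (u c) (v d) else 0 := by simp
      rw [this, ← Finset.sum_sub_distrib]
      refine Finset.sum_congr rfl fun d _ => ?_
      have e : centeredInner (fun i => X c i) (fun i => Y d i) = centeredInner (u c) (v d) := rfl
      rw [e]
      by_cases hd : (d : ℕ) < k
      · simp only [Bblock, Matrix.of_apply, hc, hd, and_self, if_true, Fin.ext_iff]
        split_ifs <;> ring
      · have : c ≠ d := by rintro rfl; exact hd hc
        simp [Bblock, hd, this]
    · simp [Bblock, hc]
  simp only [h2]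
  rw [sum_fin_ite_lt hk (fun c => centeredInner (u c) (v c) -
        (∑ d ∈ Finset.range k, centeredInner (u c) (v d)) / k),
    Finset.sum_sub_distrib, Finset.sum_div]

theorem trace_Amat_form {p t : ℕ} (n : ℕ) (a : ℕ → ℝ) (ht : 0 < t) (u v : ℕ → Fin t → ℝ) :
    (Bsq t * (Matrix.of fun (c : Fin p) i => u c i)ᵀ * Amat p n a *
      (Matrix.of fun (c : Fin p) i => v c i) * Bsq t).trace =
    ∑ j ∈ Finset.range p, alphaCoef n a (j + 1) *
      (∑ c ∈ Finset.range (j + 1), centeredInner (u c) (v c) -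
      (∑ c ∈ Finset.range (j + 1), ∑ d ∈ Finset.range (j + 1),
        centeredInner (u c) (v d)) / ((j : ℝ) + 1)) := by
  have hI : Finset.Icc 1 p = (Finset.range p).image (· + 1) := by
    ext k
    simp only [Finset.mem_Icc, Finset.mem_image, Finset.mem_range]
    exact ⟨fun h => ⟨k - 1, by omega, by omega⟩, by rintro ⟨j, hj, rfl⟩; omega⟩
  rw [Amat, hI, Finset.sum_image (by simp), Matrix.mul_sum, Matrix.sum_mul, Matrix.sum_mul,
    Matrix.trace_sum]
  refine Finset.sum_congr rfl fun j hj => ?_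
  rw [Matrix.mul_smul, Matrix.smul_mul, Matrix.smul_mul, Matrix.trace_smul,
    trace_Bblock_form ht (Finset.mem_range.mp hj), smul_eq_mul]
  push_cast
  rfl

/-- Indicator that periods `b` and `c` receive the same treatment. -/
def coinc {t : ℕ} (σ : ℕ → Fin t) (b c : ℕ) : ℝ := if σ b = σ c then 1 else 0

/-- The number of earlier periods that receive the treatment of period `c`. -/
def earlierCoinc {t : ℕ} (σ : ℕ → Fin t) (c : ℕ) : ℝ := ∑ b ∈ Finset.range c, coinc σ b c

/-- The number of pairs among the first `j` periods that receive the same treatment. -/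
def coincPairs {t : ℕ} (σ : ℕ → Fin t) (j : ℕ) : ℝ := ∑ c ∈ Finset.range j, earlierCoinc σ c

/-- The number of immediate repetitions among the first `j + 1` periods. -/
def repeats {t : ℕ} (σ : ℕ → Fin t) (j : ℕ) : ℝ := ∑ b ∈ Finset.range j, coinc σ b (b + 1)

theorem coinc_self {t : ℕ} (σ : ℕ → Fin t) (b : ℕ) : coinc σ b b = 1 := by simp [coinc]

theorem coinc_comm {t : ℕ} (σ : ℕ → Fin t) (b c : ℕ) : coinc σ b c = coinc σ c b := by
  simp [coinc, eq_comm]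

theorem coinc_nonneg {t : ℕ} (σ : ℕ → Fin t) (b c : ℕ) : 0 ≤ coinc σ b c := by
  unfold coinc; split_ifs <;> norm_num

theorem coinc_le_one {t : ℕ} (σ : ℕ → Fin t) (b c : ℕ) : coinc σ b c ≤ 1 := by
  unfold coinc; split_ifs <;> norm_num

theorem earlierCoinc_nonneg {t : ℕ} (σ : ℕ → Fin t) (c : ℕ) : 0 ≤ earlierCoinc σ c :=
  Finset.sum_nonneg fun _ _ => coinc_nonneg _ _ _

theorem coincPairs_nonneg {t : ℕ} (σ : ℕ → Fin t) (j : ℕ) : 0 ≤ coincPairs σ j :=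
  Finset.sum_nonneg fun _ _ => earlierCoinc_nonneg _ _

theorem repeats_nonneg {t : ℕ} (σ : ℕ → Fin t) (j : ℕ) : 0 ≤ repeats σ j :=
  Finset.sum_nonneg fun _ _ => coinc_nonneg _ _ _

theorem coincPairs_succ {t : ℕ} (σ : ℕ → Fin t) (j : ℕ) :
    coincPairs σ (j + 1) = coincPairs σ j + earlierCoinc σ j := Finset.sum_range_succ _ _

theorem repeats_succ {t : ℕ} (σ : ℕ → Fin t) (j : ℕ) :
    repeats σ (j + 1) = repeats σ j + coinc σ j (j + 1) := Finset.sum_range_succ _ _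

theorem coincPairs_mono {t : ℕ} (σ : ℕ → Fin t) : Monotone (coincPairs σ) :=
  monotone_nat_of_le_succ fun j => by
    rw [coincPairs_succ]; linarith [earlierCoinc_nonneg σ j]

theorem coinc_le_earlierCoinc {t : ℕ} (σ : ℕ → Fin t) {b c : ℕ} (h : b < c) :
    coinc σ b c ≤ earlierCoinc σ c :=
  Finset.single_le_sum (f := fun b => coinc σ b c) (fun _ _ => coinc_nonneg _ _ _)
    (Finset.mem_range.mpr h)

theorem repeats_le_coincPairs {t : ℕ} (σ : ℕ → Fin t) (j : ℕ) :
    repeats σ j ≤ coincPairs σ (j + 1) := by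
  induction j with
  | zero => simp [repeats, coincPairs, earlierCoinc]
  | succ j ih =>
    rw [repeats_succ, coincPairs_succ]
    linarith [coinc_le_earlierCoinc σ (Nat.lt_succ_self j)]

theorem sum_coinc_eq {t : ℕ} (σ : ℕ → Fin t) (j : ℕ) :
    ∑ c ∈ Finset.range j, ∑ d ∈ Finset.range j, coinc σ c d = j + 2 * coincPairs σ j := by
  induction j with
  | zero => simp [coincPairs]
  | succ j ih =>
    rw [coincPairs_succ]
    simp only [Finset.sum_range_succ, Finset.sum_add_distrib, ih, coinc_self, coinc_comm σ j,
      earlierCoinc]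
    push_cast
    ring

theorem coincPairs_le {t : ℕ} (σ : ℕ → Fin t) (j : ℕ) :
    (j : ℝ) + 2 * coincPairs σ j ≤ (j : ℝ) ^ 2 := by
  rw [← sum_coinc_eq]
  calc _ ≤ ∑ c ∈ Finset.range j, ∑ d ∈ Finset.range j, (1 : ℝ) := by
        gcongr; exact coinc_le_one _ _ _
    _ = _ := by simp [sq]

theorem coincPairs_eq_zero_iff {t : ℕ} (σ : ℕ → Fin t) (j : ℕ) :
    coincPairs σ j = 0 ↔ ∀ b c, b < c → c < j → σ b ≠ σ c := by
  unfold coincPairs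
  rw [Finset.sum_eq_zero_iff_of_nonneg fun _ _ => earlierCoinc_nonneg _ _]
  constructor
  · intro h b c hbc hcj he
    have := (Finset.sum_eq_zero_iff_of_nonneg fun _ _ => coinc_nonneg _ _ _).mp
      (h c (Finset.mem_range.mpr hcj)) b (Finset.mem_range.mpr hbc)
    simp [coinc, he] at this
  · intro h c hc
    refine Finset.sum_eq_zero fun b hb => ?_
    simp [coinc, h b c (Finset.mem_range.mp hb) (Finset.mem_range.mp hc)]

/-- The treatment indicator of each period. -/
def treatRow {t : ℕ} (σ : ℕ → Fin t) (c : ℕ) (i : Fin t) : ℝ := if σ c = i then 1 else 0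

/-- The carryover indicator of each period. -/
def carryRow {t : ℕ} (σ : ℕ → Fin t) (c : ℕ) (i : Fin t) : ℝ :=
  if c = 0 then 0 else treatRow σ (c - 1) i

theorem Tmat_eq {p t : ℕ} (σ : ℕ → Fin t) :
    Tmat (fun k : Fin p => σ k) = Matrix.of fun (c : Fin p) i => treatRow σ c i := rfl

theorem Fmat_eq {p t : ℕ} (σ : ℕ → Fin t) :
    Fmat (fun k : Fin p => σ k) = Matrix.of fun (c : Fin p) i => carryRow σ c i := rfl

theorem centeredInner_treatRow {t : ℕ} (σ : ℕ → Fin t) (b c : ℕ) :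
    centeredInner (treatRow σ b) (treatRow σ c) = coinc σ b c - 1 / t := by
  simp [centeredInner, treatRow, coinc, eq_comm]

theorem carryRow_zero {t : ℕ} (σ : ℕ → Fin t) : carryRow σ 0 = 0 := by
  ext i; simp [carryRow]

theorem carryRow_succ {t : ℕ} (σ : ℕ → Fin t) (c : ℕ) : carryRow σ (c + 1) = treatRow σ c := by
  ext i; simp [carryRow]

theorem centeredInner_zero_left {t : ℕ} (v : Fin t → ℝ) : centeredInner 0 v = 0 := by
  simp [centeredInner]

theorem centeredInner_zero_right {t : ℕ} (v : Fin t → ℝ) : centeredInner v 0 = 0 := by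
  simp [centeredInner]

theorem q11_eq {p t : ℕ} (n : ℕ) (a : ℕ → ℝ) (ht : 0 < t) (σ : ℕ → Fin t) :
    q11 p t n a (fun k => σ k) = ∑ j ∈ Finset.range p, alphaCoef n a (j + 1) *
      (((j : ℝ) + 1) - (j + 2 * coincPairs σ j + 2 * earlierCoinc σ j + 1) / ((j : ℝ) + 1)) := by
  have : (t : ℝ) ≠ 0 := by positivity
  rw [q11, Tmat_eq, trace_Amat_form n a ht]
  refine Finset.sum_congr rfl fun j _ => ?_
  congr 1
  simp only [centeredInner_treatRow, Finset.sum_sub_distrib, sum_coinc_eq, coincPairs_succ,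
    coinc_self]
  simp only [Finset.sum_const, Finset.card_range, nsmul_eq_mul]
  push_cast
  field_simp
  ring

theorem q12_eq {p t : ℕ} (n : ℕ) (a : ℕ → ℝ) (ht : 0 < t) (σ : ℕ → Fin t) :
    q12 p t n a (fun k => σ k) = ∑ j ∈ Finset.range p, alphaCoef n a (j + 1) *
      (repeats σ j - (j + 2 * coincPairs σ j + earlierCoinc σ j) / ((j : ℝ) + 1)) := by
  have : (t : ℝ) ≠ 0 := by positivity
  rw [q12, Tmat_eq, Fmat_eq, trace_Amat_form n a ht]
  refine Finset.sum_congr rfl fun j _ => ?_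
  congr 1
  simp only [Finset.sum_range_succ' (fun c => centeredInner _ (carryRow σ c)), carryRow_zero,
    carryRow_succ, centeredInner_zero_right, add_zero]
  simp only [centeredInner_treatRow, Finset.sum_sub_distrib, Finset.sum_range_succ (fun c => ∑ _ ∈ _, _),
    sum_coinc_eq, Finset.sum_const, Finset.card_range, nsmul_eq_mul]
  simp only [coinc_comm σ j]
  have h1 : ∑ c ∈ Finset.range j, coinc σ (c + 1) c = repeats σ j :=
    Finset.sum_congr rfl fun c _ => coinc_comm _ _ _
  have h2 : ∑ c ∈ Finset.range j, coinc σ c j = earlierCoinc σ j := rfl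
  rw [h1, h2]
  push_cast
  field_simp
  ring

theorem q22_eq {p t : ℕ} (n : ℕ) (a : ℕ → ℝ) (ht : 0 < t) (σ : ℕ → Fin t) :
    q22 p t n a (fun k => σ k) = ∑ j ∈ Finset.range p, alphaCoef n a (j + 1) *
      ((((j : ℝ) + 1) * j - j / t - (j + 2 * coincPairs σ j)) / ((j : ℝ) + 1)) := by
  have : (t : ℝ) ≠ 0 := by positivity
  rw [q22, Fmat_eq, trace_Amat_form n a ht]
  refine Finset.sum_congr rfl fun j _ => ?_
  congr 1
  simp only [Finset.sum_range_succ' (n := j), carryRow_zero, carryRow_succ,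
    centeredInner_zero_right, centeredInner_zero_left, add_zero, Finset.sum_const_zero,
    centeredInner_treatRow, Finset.sum_sub_distrib, sum_coinc_eq, coinc_self,
    Finset.sum_const, Finset.card_range, nsmul_eq_mul]
  field_simp
  ring

/-- The contribution of subjects that stay for `j + 1` periods to `q_s(x)`, in terms of the number
`E` of coinciding pairs among the first `j` periods, the number `L` of coincidences of the last
period with earlier ones, and the number `R` of immediate repetitions. -/
def periodValue (t j : ℕ) (E L R x : ℝ) : ℝ :=
  (((j : ℝ) + 1) ^ 2 - 1 + x ^ 2 * (((j : ℝ) + 1) * j - j / t) - (1 + x) ^ 2 * (j + 2 * E) -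
    2 * (1 + x) * L + 2 * x * ((j : ℝ) + 1) * R) / ((j : ℝ) + 1)

theorem qfun_eq {p t : ℕ} (n : ℕ) (a : ℕ → ℝ) (ht : 0 < t) (σ : ℕ → Fin t) (x : ℝ) :
    qfun p t n a (fun k => σ k) x = ∑ j ∈ Finset.range p, alphaCoef n a (j + 1) *
      periodValue t j (coincPairs σ j) (earlierCoinc σ j) (repeats σ j) x := by
  rw [qfun, q11_eq n a ht, q12_eq n a ht, q22_eq n a ht, Finset.mul_sum, Finset.sum_mul,
    Finset.sum_mul, ← Finset.sum_add_distrib, ← Finset.sum_add_distrib]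
  refine Finset.sum_congr rfl fun j _ => ?_
  unfold periodValue
  field_simp
  ring

/-- The common value of `q_s(x)` over the sequences `s` of `⟨re⟩`, for `p = q + 2` periods. -/
def reValue (q t n : ℕ) (a : ℕ → ℝ) (x : ℝ) : ℝ :=
  ∑ j ∈ Finset.range (q + 1), alphaCoef n a (j + 1) * periodValue t j 0 0 0 x +
    alphaCoef n a (q + 2) * periodValue t (q + 1) 0 1 1 x

theorem periodValue_le {t : ℕ} (σ : ℕ → Fin t) (j : ℕ) {x : ℝ} (hx : 0 ≤ x)
    (hj : (j : ℝ) * x ≤ 1) :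
    periodValue t j (coincPairs σ j) (earlierCoinc σ j) (repeats σ j) x ≤
      periodValue t j 0 0 0 x := by
  have hR := repeats_le_coincPairs σ j
  rw [coincPairs_succ] at hR
  have hE := coincPairs_nonneg σ j
  have hL := earlierCoinc_nonneg σ j
  unfold periodValue
  gcongr ?_ / _
  nlinarith [mul_le_mul_of_nonneg_left hR (by positivity : 0 ≤ 2 * x * ((j : ℝ) + 1)),
    mul_nonneg hL (sub_nonneg.mpr hj), mul_nonneg hE (sub_nonneg.mpr hj), mul_nonneg hE hx,
    mul_nonneg hE (sq_nonneg x)]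

theorem last_periodValue_le {t : ℕ} (σ : ℕ → Fin t) (q : ℕ) {x : ℝ} (hx : 0 ≤ x)
    (hlow : 1 < ((q : ℝ) + 1) * x) (hhigh : (q : ℝ) * x < 1) :
    periodValue t (q + 1) (coincPairs σ (q + 1)) (earlierCoinc σ (q + 1)) (repeats σ (q + 1)) x ≤
      periodValue t (q + 1) 0 1 1 x ∧
    (periodValue t (q + 1) (coincPairs σ (q + 1)) (earlierCoinc σ (q + 1))
        (repeats σ (q + 1)) x = periodValue t (q + 1) 0 1 1 x →
      coincPairs σ (q + 1) = 0 ∧ coinc σ q (q + 1) = 1) := by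
  have hR := repeats_le_coincPairs σ q
  have hE := coincPairs_nonneg σ (q + 1)
  have hL := coinc_le_earlierCoinc σ (Nat.lt_succ_self q)
  have hD := coinc_le_one σ q (q + 1)
  have hRs := repeats_succ σ q
  set E := coincPairs σ (q + 1)
  set L := earlierCoinc σ (q + 1)
  set D := coinc σ q (q + 1)
  have key : periodValue t (q + 1) E L (repeats σ (q + 1)) x ≤
      periodValue t (q + 1) 0 1 1 x -
        2 * (E * (1 - q * x) + (1 - D) * (((q : ℝ) + 1) * x - 1)) / ((q : ℝ) + 2) := by
    unfold periodValue
    push_cast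
    rw [show (q : ℝ) + 1 + 1 = q + 2 by ring, ← sub_div]
    gcongr ?_ / _
    nlinarith [mul_le_mul_of_nonneg_left (show repeats σ (q + 1) ≤ E + D by linarith)
      (by positivity : 0 ≤ 2 * x * ((q : ℝ) + 2)), mul_nonneg hE (sq_nonneg x),
      mul_nonneg (sub_nonneg.mpr hL) (by positivity : 0 ≤ 1 + x)]
  have h1 : 0 ≤ E * (1 - q * x) := mul_nonneg hE (by linarith)
  have h2 : 0 ≤ (1 - D) * (((q : ℝ) + 1) * x - 1) := mul_nonneg (by linarith) (by linarith)
  refine ⟨key.trans (sub_le_self _ (by positivity)), fun he => ?_⟩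
  have h3 : 2 * (E * (1 - q * x) + (1 - D) * (((q : ℝ) + 1) * x - 1)) / ((q : ℝ) + 2) ≤ 0 := by
    linarith
  have h4 := (div_le_iff₀ (by positivity : 0 < (q : ℝ) + 2)).mp h3
  constructor
  · have : E * (1 - q * x) = 0 := by linarith
    rcases mul_eq_zero.mp this with h | h
    · exact h
    · linarith
  · have : (1 - D) * (((q : ℝ) + 1) * x - 1) = 0 := by linarith
    rcases mul_eq_zero.mp this with h | h <;> linarith

theorem qfun_le_reValue {q t : ℕ} (n : ℕ) (a : ℕ → ℝ) (ht : 0 < t)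
    (hα : ∀ j < q + 2, 0 ≤ alphaCoef n a (j + 1)) (hαp : 0 < alphaCoef n a (q + 2))
    (σ : ℕ → Fin t) {x : ℝ} (hx : 0 ≤ x)
    (hlow : 1 < ((q : ℝ) + 1) * x) (hhigh : (q : ℝ) * x < 1) :
    qfun (q + 2) t n a (fun k => σ k) x ≤ reValue q t n a x ∧
    (qfun (q + 2) t n a (fun k => σ k) x = reValue q t n a x →
      coincPairs σ (q + 1) = 0 ∧ coinc σ q (q + 1) = 1) := by
  rw [qfun_eq n a ht, Finset.sum_range_succ, reValue]
  obtain ⟨h1, h2⟩ := last_periodValue_le σ q hx hlow hhigh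
  have h3 : ∑ j ∈ Finset.range (q + 1), alphaCoef n a (j + 1) *
      periodValue t j (coincPairs σ j) (earlierCoinc σ j) (repeats σ j) x ≤
      ∑ j ∈ Finset.range (q + 1), alphaCoef n a (j + 1) * periodValue t j 0 0 0 x := by
    refine Finset.sum_le_sum fun j hj => ?_
    have hj' := Finset.mem_range.mp hj
    refine mul_le_mul_of_nonneg_left (periodValue_le σ j hx ?_) (hα j (by omega))
    have : (j : ℝ) ≤ q := by exact_mod_cast Nat.lt_succ_iff.mp hj'
    nlinarith
  have h4 := mul_le_mul_of_nonneg_left h1 hαp.le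
  refine ⟨add_le_add h3 h4, fun he => h2 ?_⟩
  exact mul_left_cancel₀ hαp.ne' (le_antisymm h4 (by linarith))

theorem qfun_eq_reValue {q t : ℕ} (n : ℕ) (a : ℕ → ℝ) (ht : 0 < t) (σ : ℕ → Fin t)
    (hE : coincPairs σ (q + 1) = 0) (hD : σ q = σ (q + 1)) (x : ℝ) :
    qfun (q + 2) t n a (fun k => σ k) x = reValue q t n a x := by
  have hE0 : ∀ j ≤ q + 1, coincPairs σ j = 0 := fun j hj =>
    le_antisymm (hE ▸ coincPairs_mono σ hj) (coincPairs_nonneg σ j)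
  have hL0 : ∀ j ≤ q, earlierCoinc σ j = 0 := fun j hj => by
    have := coincPairs_succ σ j
    rw [hE0 _ (by omega), hE0 _ (by omega)] at this
    linarith
  have hR0 : ∀ j ≤ q, repeats σ j = 0 := fun j hj =>
    le_antisymm (hE0 (j + 1) (by omega) ▸ repeats_le_coincPairs σ j) (repeats_nonneg σ j)
  have hR : repeats σ (q + 1) = 1 := by
    rw [repeats_succ, hR0 q le_rfl, coinc, if_pos hD, zero_add]
  have hL : earlierCoinc σ (q + 1) = 1 := by
    have : ∀ b, coinc σ b (q + 1) = coinc σ b q := fun b => by rw [coinc, coinc, hD]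
    have h := hL0 q le_rfl
    unfold earlierCoinc at h ⊢
    simp only [this, Finset.sum_range_succ, h, coinc_self, zero_add]
  rw [qfun_eq n a ht, Finset.sum_range_succ, reValue, hE, hL, hR]
  congr 1
  refine Finset.sum_congr rfl fun j hj => ?_
  have hj' := Finset.mem_range.mp hj
  rw [hE0 j (by omega), hL0 j (by omega), hR0 j (by omega)]

theorem mem_reSet_iff {q t : ℕ} (σ : ℕ → Fin t) :
    (fun k : Fin (q + 2) => σ k) ∈ reSet (q + 2) t ↔
      coincPairs σ (q + 1) = 0 ∧ σ q = σ (q + 1) := by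
  rw [coincPairs_eq_zero_iff]
  constructor
  · rintro ⟨h1, h2⟩
    refine ⟨fun b c hbc hc he => ?_, (h2 (by omega) (by omega)).symm⟩
    have := h1 ⟨b, by omega⟩ ⟨c, by omega⟩ (by simp; omega) (by simp; omega) he
    simp only [Fin.mk.injEq] at this
    omega
  · rintro ⟨h1, h2⟩
    refine ⟨fun j j' hj hj' he => ?_, fun _ _ => h2.symm⟩
    rcases lt_trichotomy (j : ℕ) j' with h | h | h
    · exact absurd he (h1 _ _ h (by omega))
    · exact Fin.ext h
    · exact absurd he.symm (h1 _ _ h (by omega))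

theorem exists_extension {p t : ℕ} (s : Fin (p + 1) → Fin t) :
    ∃ σ : ℕ → Fin t, s = fun k : Fin (p + 1) => σ k :=
  ⟨fun k => s (Fin.ofNat (p + 1) k), by ext k; simp⟩

theorem exists_mem_reSet {q t : ℕ} (h : q < t) : ∃ s, s ∈ reSet (q + 2) t := by
  refine ⟨_, (mem_reSet_iff (fun k => (⟨min k q, by omega⟩ : Fin t))).mpr ⟨?_, by simp⟩⟩
  rw [coincPairs_eq_zero_iff]
  intro b c hbc hc
  simp only [ne_eq, Fin.mk.injEq]
  omega

theorem alphaCoef_nonneg {n p : ℕ} {a : ℕ → ℝ} (ha0 : ∀ k ∈ Finset.Icc 1 p, 0 ≤ a k)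
    (hsum : ∑ k ∈ Finset.Icc 1 p, a k = 1) {j : ℕ} (hj : j < p) :
    0 ≤ alphaCoef n a (j + 1) := by
  have hS : aInt a 1 (j + 1) = aInt a 1 j + a (j + 1) := by
    rw [aInt, aInt, Finset.sum_Icc_succ_top (by omega)]
  have h0 : 0 ≤ aInt a 1 j := Finset.sum_nonneg fun k hk => ha0 k (by
    simp only [Finset.mem_Icc] at hk ⊢; omega)
  have h1 : aInt a 1 (j + 1) ≤ 1 := by
    rw [← hsum]
    refine Finset.sum_le_sum_of_subset_of_nonneg (fun k hk => ?_) fun k hk _ => ha0 k hk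
    simp only [Finset.mem_Icc] at hk ⊢; omega
  have ha : 0 ≤ a (j + 1) := ha0 _ (by simp only [Finset.mem_Icc]; omega)
  have key : ∀ N : ℕ, (aInt a 1 j + a (j + 1)) ^ (N + 1) ≤
      aInt a 1 j ^ (N + 1) + ((N : ℝ) + 1) * a (j + 1) := by
    intro N
    induction N with
    | zero => simp
    | succ N ih =>
      have hp : aInt a 1 j ^ (N + 1) ≤ 1 := pow_le_one₀ h0 (by linarith)
      have hm := mul_le_mul_of_nonneg_left ih (add_nonneg h0 ha)
      have hN : 0 ≤ ((N : ℝ) + 1) * a (j + 1) := by positivity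
      rw [pow_succ' _ (N + 1), pow_succ' (aInt a 1 j) (N + 1)]
      push_cast
      nlinarith [mul_le_mul_of_nonneg_right hp ha,
        mul_le_mul_of_nonneg_left (show aInt a 1 j + a (j + 1) ≤ 1 by linarith) hN]
  unfold alphaCoef
  rw [Nat.add_sub_cancel, hS]
  have := key n
  refine div_nonneg (by linarith) (by positivity)

theorem alphaCoef_eq_zero {n m : ℕ} {a : ℕ → ℝ} (h : ∀ k, 1 ≤ k → k < m → a k = 0) {k : ℕ}
    (hk1 : 1 ≤ k) (hkm : k < m) : alphaCoef n a k = 0 := by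
  have hz : ∀ j < m, aInt a 1 j = 0 := fun j hj => Finset.sum_eq_zero fun i hi => by
    simp only [Finset.mem_Icc] at hi
    exact h i hi.1 (by omega)
  simp [alphaCoef, hz k hkm, hz (k - 1) (by omega), h k hk1 hkm]

theorem sum_Icc_eq_sum_range {m p : ℕ} (hm : 1 ≤ m) (f : ℕ → ℝ)
    (hf : ∀ k, 1 ≤ k → k < m → f k = 0) :
    ∑ k ∈ Finset.Icc m p, f k = ∑ j ∈ Finset.range p, f (j + 1) := by
  have hI : Finset.Icc 1 p = (Finset.range p).image (· + 1) := by
    ext k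
    simp only [Finset.mem_Icc, Finset.mem_image, Finset.mem_range]
    exact ⟨fun h => ⟨k - 1, by omega, by omega⟩, by rintro ⟨j, hj, rfl⟩; omega⟩
  rw [← Finset.sum_image (f := f) (g := (· + 1)) (by simp), ← hI]
  refine Finset.sum_subset (Finset.Icc_subset_Icc hm le_rfl) fun k hk hk' => hf k ?_ ?_ <;>
    simp only [Finset.mem_Icc] at hk hk' <;> omega

theorem reValue_eq {q t : ℕ} (n : ℕ) (a : ℕ → ℝ) (x : ℝ) :
    reValue q t n a x =
      (∑ j ∈ Finset.range (q + 2),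
        alphaCoef n a (j + 1) * ((j : ℝ) * (j - 1 / t) / ((j : ℝ) + 1))) * x ^ 2 -
      2 * (∑ j ∈ Finset.range (q + 1), alphaCoef n a (j + 1) * ((j : ℝ) / ((j : ℝ) + 1))) * x +
      ∑ j ∈ Finset.range (q + 2), alphaCoef n a (j + 1) * (j : ℝ) -
      2 * alphaCoef n a (q + 2) / ((q : ℝ) + 2) := by
  have h1 : ∑ j ∈ Finset.range (q + 1), alphaCoef n a (j + 1) * periodValue t j 0 0 0 x =
      (∑ j ∈ Finset.range (q + 1),
        alphaCoef n a (j + 1) * ((j : ℝ) * (j - 1 / t) / ((j : ℝ) + 1))) * x ^ 2 -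
      2 * (∑ j ∈ Finset.range (q + 1), alphaCoef n a (j + 1) * ((j : ℝ) / ((j : ℝ) + 1))) * x +
      ∑ j ∈ Finset.range (q + 1), alphaCoef n a (j + 1) * (j : ℝ) := by
    rw [Finset.mul_sum, Finset.sum_mul, Finset.sum_mul, ← Finset.sum_sub_distrib,
      ← Finset.sum_add_distrib]
    refine Finset.sum_congr rfl fun j _ => ?_
    unfold periodValue
    field_simp
    ring
  rw [reValue, h1, Finset.sum_range_succ _ (q + 1), Finset.sum_range_succ _ (q + 1)]
  have h2 : periodValue t (q + 1) 0 1 1 x =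
      ((q : ℝ) + 1) * (q + 1 - 1 / t) / ((q : ℝ) + 2) * x ^ 2 + (q + 1) - 2 / ((q : ℝ) + 2) := by
    unfold periodValue
    push_cast
    field_simp
    ring
  rw [h2]
  push_cast
  rw [show (q : ℝ) + 1 + 1 = q + 2 by ring]
  ring

theorem q22_pos {q t : ℕ} (n : ℕ) (a : ℕ → ℝ) (ht : 2 ≤ t)
    (hα : ∀ j < q + 2, 0 ≤ alphaCoef n a (j + 1)) (hαp : 0 < alphaCoef n a (q + 2))
    (σ : ℕ → Fin t) : 0 < q22 (q + 2) t n a (fun k => σ k) := by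
  have hinv : (1 : ℝ) / t < 1 := by
    rw [div_lt_one (by positivity)]; exact_mod_cast ht
  have hle : ∀ j : ℕ, (j : ℝ) * (1 - 1 / t) ≤
      ((j : ℝ) + 1) * j - j / t - (j + 2 * coincPairs σ j) := fun j => by
    have := coincPairs_le σ j
    rw [show (j : ℝ) / t = j * (1 / t) by ring]
    nlinarith
  rw [q22_eq n a (by omega), Finset.sum_range_succ]
  refine add_pos_of_nonneg_of_pos (Finset.sum_nonneg fun j hj => ?_) ?_
  · have := Finset.mem_range.mp hj
    refine mul_nonneg (hα j (by omega)) (div_nonneg (le_trans ?_ (hle j)) (by positivity))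
    exact mul_nonneg (by positivity) (by linarith)
  · refine mul_pos hαp (div_pos (lt_of_lt_of_le ?_ (hle _)) (by positivity))
    exact mul_pos (by positivity) (by linarith)

theorem bddBelow_range_quadratic {b c d : ℝ} (hd : 0 < d) :
    BddBelow (Set.range fun x : ℝ => b + 2 * c * x + d * x ^ 2) := by
  refine ⟨b - c ^ 2 / d, ?_⟩
  rintro _ ⟨x, rfl⟩
  have : b + 2 * c * x + d * x ^ 2 - (b - c ^ 2 / d) = d * (x + c / d) ^ 2 := by
    field_simp; ring
  have h2 : 0 ≤ d * (x + c / d) ^ 2 := by positivity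
  simp only
  linarith

theorem IsDesign.exists_pos {p t : ℕ} {P : (Fin p → Fin t) → ℝ} (hP : IsDesign P) :
    ∃ s, 0 < P s := by
  by_contra! h
  linarith [hP.2, Finset.sum_nonpos fun s (_ : s ∈ Finset.univ) => h s]

theorem bddBelow_range_design {q t : ℕ} (n : ℕ) (a : ℕ → ℝ) (ht : 2 ≤ t)
    (hα : ∀ j < q + 2, 0 ≤ alphaCoef n a (j + 1)) (hαp : 0 < alphaCoef n a (q + 2))
    {P : (Fin (q + 2) → Fin t) → ℝ} (hP : IsDesign P) :
    BddBelow (Set.range fun x : ℝ => ∑ s, P s * qfun (q + 2) t n a s x) := by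
  have hq : ∀ s, 0 < q22 (q + 2) t n a s := fun s => by
    obtain ⟨σ, rfl⟩ := exists_extension s
    exact q22_pos n a ht hα hαp σ
  obtain ⟨s₀, hs₀⟩ := hP.exists_pos
  have h := bddBelow_range_quadratic (b := ∑ s, P s * q11 (q + 2) t n a s)
    (c := ∑ s, P s * q12 (q + 2) t n a s) (d := ∑ s, P s * q22 (q + 2) t n a s)
    (Finset.sum_pos' (fun s _ => mul_nonneg (hP.1 s) (hq s).le)
      ⟨s₀, Finset.mem_univ _, mul_pos hs₀ (hq s₀)⟩)
  convert h using 3 with x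
  rw [Finset.mul_sum, Finset.sum_mul, Finset.sum_mul, ← Finset.sum_add_distrib,
    ← Finset.sum_add_distrib]
  exact Finset.sum_congr rfl fun s _ => by rw [qfun]; ring

theorem qmin_le_eval {q t : ℕ} (n : ℕ) (a : ℕ → ℝ) (ht : 2 ≤ t)
    (hα : ∀ j < q + 2, 0 ≤ alphaCoef n a (j + 1)) (hαp : 0 < alphaCoef n a (q + 2))
    {P : (Fin (q + 2) → Fin t) → ℝ} (hP : IsDesign P) (x : ℝ) :
    qmin (q + 2) t n a P ≤ ∑ s, P s * qfun (q + 2) t n a s x :=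
  csInf_le (bddBelow_range_design n a ht hα hαp hP) ⟨x, rfl⟩

theorem IsDesign.sum_mul_le {p t : ℕ} {P : (Fin p → Fin t) → ℝ} (hP : IsDesign P)
    {f : (Fin p → Fin t) → ℝ} {y : ℝ} (hf : ∀ s, f s ≤ y) : ∑ s, P s * f s ≤ y := by
  calc _ ≤ ∑ s, P s * y := Finset.sum_le_sum fun s _ => mul_le_mul_of_nonneg_left (hf s) (hP.1 s)
    _ = y := by rw [← Finset.sum_mul, hP.2, one_mul]

theorem IsDesign.mul_eq_mul_of_sum_eq {p t : ℕ} {P : (Fin p → Fin t) → ℝ} (hP : IsDesign P)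
    {f : (Fin p → Fin t) → ℝ} {y : ℝ} (hf : ∀ s, f s ≤ y) (h : ∑ s, P s * f s = y)
    (s : Fin p → Fin t) : P s * f s = P s * y := by
  refine (Finset.sum_eq_sum_iff_of_le fun s _ =>
    mul_le_mul_of_nonneg_left (hf s) (hP.1 s)).mp ?_ s (Finset.mem_univ _)
  rw [h, ← Finset.sum_mul, hP.2, one_mul]

/-- If `q_s(x₀)` is maximal exactly on `⟨re⟩`, and `x₀` minimizes the common value of `q_s` on
`⟨re⟩`, then `y*` is this minimum. -/
theorem ystar_eq_reValue {q t : ℕ} (n : ℕ) (a : ℕ → ℝ) (ht : 2 ≤ t) (hqt : q < t)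
    (hα : ∀ j < q + 2, 0 ≤ alphaCoef n a (j + 1)) (hαp : 0 < alphaCoef n a (q + 2)) {x₀ : ℝ}
    (hle : ∀ s, qfun (q + 2) t n a s x₀ ≤ reValue q t n a x₀)
    (hre : ∀ s ∈ reSet (q + 2) t, ∀ x, qfun (q + 2) t n a s x = reValue q t n a x)
    (hmin : ∀ x, reValue q t n a x₀ ≤ reValue q t n a x) :
    ystar (q + 2) t n a = reValue q t n a x₀ := by
  refine IsGreatest.csSup_eq ⟨?_, ?_⟩
  · obtain ⟨s, hs⟩ := exists_mem_reSet (t := t) hqt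
    refine ⟨fun r => if r = s then 1 else 0, ⟨fun r => by positivity, by simp⟩, ?_⟩
    have h : reValue q t n a x₀ ∈ Set.range fun x : ℝ =>
        ∑ r, (if r = s then (1 : ℝ) else 0) * qfun (q + 2) t n a r x := ⟨x₀, by simp [hre s hs]⟩
    refine (IsLeast.csInf_eq ⟨h, ?_⟩).symm
    rintro _ ⟨x, rfl⟩
    simpa [hre s hs] using hmin x
  · rintro y ⟨P, hP, rfl⟩
    exact (qmin_le_eval n a ht hα hαp hP x₀).trans (hP.sum_mul_le hle)

/-- Theorem 3.3(iii): if `p ≤ t` and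
`x₀ = (∑_{k=m}^{p−1} α_k (k−1)/k) / (∑_{k=m}^p α_k (k−1)(k−1−1/t)/k)` satisfies
`1/(p−1) < x₀ < 1/(p−2)`, then `x* = x₀`,
`y* = ∑_{k=m}^p α_k (k−1)(1−1/k−1/(kt)) x₀² − 2 ∑_{k=m}^{p−1} α_k (1−1/k) x₀ +
∑_{k=m}^p α_k (k−1) − 2α_p/p`, and `T = ⟨re⟩`. -/
theorem theorem33_part_iii
    (p t n : ℕ) (hp : 3 ≤ p) (ht : 2 ≤ t) (hn : 1 ≤ n)
    (a : ℕ → ℝ) (ha0 : ∀ k ∈ Finset.Icc 1 p, 0 ≤ a k)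
    (hsum : ∑ k ∈ Finset.Icc 1 p, a k = 1)
    (hex : ∃ k ∈ Finset.Icc 2 p, 0 < a k)
    (m : ℕ) (hm1 : 1 ≤ m) (hmp : m ≤ p) (hma : 0 < a m)
    (hmmin : ∀ k, 1 ≤ k → k < m → a k = 0)
    (hpt : p ≤ t)
    (Pstar : (Fin p → Fin t) → ℝ) (hPstar : IsDesign Pstar)
    (hPmax : qmin p t n a Pstar = ystar p t n a)
    (xstar : ℝ)
    (hxstar : ∑ s, Pstar s * qfun p t n a s xstar = ystar p t n a)
    (x0 : ℝ)
    (hx0 : x0 = (∑ k ∈ Finset.Icc m (p - 1), alphaCoef n a k * ((k : ℝ) - 1) / k) /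
      (∑ k ∈ Finset.Icc m p, alphaCoef n a k * ((k : ℝ) - 1) * ((k : ℝ) - 1 - 1 / t) / k))
    (hlow : 1 / ((p : ℝ) - 1) < x0) (hhigh : x0 < 1 / ((p : ℝ) - 2)) :
    xstar = x0 ∧
    ystar p t n a =
      (∑ k ∈ Finset.Icc m p, alphaCoef n a k * ((k : ℝ) - 1) *
          (1 - 1 / k - 1 / ((k : ℝ) * t))) * x0 ^ 2 -
        2 * (∑ k ∈ Finset.Icc m (p - 1), alphaCoef n a k * (1 - 1 / (k : ℝ))) * x0 +
        (∑ k ∈ Finset.Icc m p, alphaCoef n a k * ((k : ℝ) - 1)) -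
        2 * alphaCoef n a p / p ∧
    {s : Fin p → Fin t | qfun p t n a s xstar = ystar p t n a} = reSet p t := by
  obtain ⟨q, rfl⟩ : ∃ q, p = q + 2 := ⟨p - 2, by omega⟩
  have hα : ∀ j < q + 2, 0 ≤ alphaCoef n a (j + 1) := fun j hj => alphaCoef_nonneg ha0 hsum hj
  have hz : ∀ k, 1 ≤ k → k < m → alphaCoef n a k = 0 := fun k => alphaCoef_eq_zero hmmin
  have htpos : (0 : ℝ) < t := by positivity
  have hinv : (1 : ℝ) / t < 1 := by
    rw [div_lt_one htpos]; exact_mod_cast ht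
  have hinv0 : (0 : ℝ) < 1 / t := by positivity
  have hqpos : (0 : ℝ) < q := by exact_mod_cast (by omega : 0 < q)
  set c₁ := ∑ j ∈ Finset.range (q + 1), alphaCoef n a (j + 1) * ((j : ℝ) / ((j : ℝ) + 1)) with hc₁
  set c₂ := ∑ j ∈ Finset.range (q + 2),
    alphaCoef n a (j + 1) * ((j : ℝ) * (j - 1 / t) / ((j : ℝ) + 1)) with hc₂
  rw [show q + 2 - 1 = q + 1 by omega,
    sum_Icc_eq_sum_range hm1 _ fun k h1 h2 => by simp [hz k h1 h2],
    sum_Icc_eq_sum_range hm1 _ fun k h1 h2 => by simp [hz k h1 h2]] at hx0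
  have hx0' : x0 = c₁ / c₂ := by
    rw [hx0]
    congr 1 <;> refine Finset.sum_congr rfl fun j _ => ?_ <;> push_cast <;> ring
  clear hx0
  push_cast at hlow hhigh
  rw [show (q : ℝ) + 2 - 1 = q + 1 by ring, div_lt_iff₀ (by positivity), mul_comm] at hlow
  rw [show (q : ℝ) + 2 - 2 = q by ring, lt_div_iff₀ hqpos, mul_comm] at hhigh
  have hxpos : 0 < x0 := by
    by_contra! h
    nlinarith
  have hc₂0 : 0 ≤ c₂ := Finset.sum_nonneg fun j hj => by
    refine mul_nonneg (hα j (Finset.mem_range.mp hj)) ?_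
    rcases j.eq_zero_or_pos with rfl | hj0
    · simp
    · have : (1 : ℝ) ≤ j := by exact_mod_cast hj0
      exact div_nonneg (mul_nonneg (by positivity) (by linarith)) (by positivity)
  have hc₂pos : 0 < c₂ := hc₂0.lt_of_ne fun h => by
    rw [← h, div_zero] at hx0'
    exact hxpos.ne' hx0'
  have hc₁ : c₁ = x0 * c₂ := by rw [hx0', div_mul_cancel₀ _ hc₂pos.ne']
  have hαp : 0 < alphaCoef n a (q + 2) := by
    refine (hα (q + 1) (by omega)).lt_of_ne fun h => ?_
    have hle : c₂ ≤ q * c₁ := by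
      rw [hc₂, Finset.sum_range_succ, ← h, zero_mul, add_zero, Finset.mul_sum]
      refine Finset.sum_le_sum fun j hj => ?_
      have hj' := Finset.mem_range.mp hj
      have hjq : (j : ℝ) ≤ q := by exact_mod_cast Nat.lt_succ_iff.mp hj'
      have h3 : 0 ≤ alphaCoef n a (j + 1) * ((j : ℝ) / ((j : ℝ) + 1)) :=
        mul_nonneg (hα j (by omega)) (by positivity)
      calc _ = ((j : ℝ) - 1 / t) * (alphaCoef n a (j + 1) * ((j : ℝ) / ((j : ℝ) + 1))) := by ring
        _ ≤ _ := mul_le_mul_of_nonneg_right (by linarith) h3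
    nlinarith
  have hV : ∀ x, reValue q t n a x = reValue q t n a x0 + c₂ * (x - x0) ^ 2 := fun x => by
    rw [reValue_eq, reValue_eq, ← hc₂]
    linear_combination 2 * (x0 - x) * hc₁
  have hmin : ∀ x, reValue q t n a x0 ≤ reValue q t n a x := fun x => by
    rw [hV x]; exact le_add_of_nonneg_right (by positivity)
  have hle : ∀ s, qfun (q + 2) t n a s x0 ≤ reValue q t n a x0 := fun s => by
    obtain ⟨σ, rfl⟩ := exists_extension s
    exact (qfun_le_reValue n a (by omega) hα hαp σ hxpos.le hlow hhigh).1
  have hre : ∀ s ∈ reSet (q + 2) t, ∀ x, qfun (q + 2) t n a s x = reValue q t n a x := by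
    intro s hs
    obtain ⟨σ, rfl⟩ := exists_extension s
    obtain ⟨hE, hD⟩ := (mem_reSet_iff σ).mp hs
    exact qfun_eq_reValue n a (by omega) σ hE hD
  have hmem : ∀ s, qfun (q + 2) t n a s x0 = reValue q t n a x0 → s ∈ reSet (q + 2) t := by
    intro s hs
    obtain ⟨σ, rfl⟩ := exists_extension s
    obtain ⟨hE, hD⟩ := (qfun_le_reValue n a (by omega) hα hαp σ hxpos.le hlow hhigh).2 hs
    refine (mem_reSet_iff σ).mpr ⟨hE, ?_⟩
    by_contra h
    simp [coinc, h] at hD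
  have hy := ystar_eq_reValue n a ht (by omega) hα hαp hle hre hmin
  have hQ0 : ∑ s, Pstar s * qfun (q + 2) t n a s x0 = reValue q t n a x0 :=
    le_antisymm (hPstar.sum_mul_le hle)
      (hy ▸ hPmax ▸ qmin_le_eval n a ht hα hαp hPstar x0)
  have hQ : ∀ x, ∑ s, Pstar s * qfun (q + 2) t n a s x = reValue q t n a x := fun x => by
    rw [← one_mul (reValue q t n a x), ← hPstar.2, Finset.sum_mul]
    refine Finset.sum_congr rfl fun s _ => ?_
    rcases eq_or_ne (Pstar s) 0 with h | h
    · rw [h, zero_mul, zero_mul]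
    · rw [hre s (hmem s (mul_left_cancel₀ h (hPstar.mul_eq_mul_of_sum_eq hle hQ0 s)))]
  have hx : xstar = x0 := by
    rw [hQ, hV, hy, add_eq_left] at hxstar
    have := (mul_eq_zero.mp hxstar).resolve_left hc₂pos.ne'
    linarith [pow_eq_zero_iff (two_ne_zero) |>.mp this]
  refine ⟨hx, ?_, ?_⟩
  · rw [hy, reValue_eq, show q + 2 - 1 = q + 1 by omega,
      sum_Icc_eq_sum_range hm1 _ fun k h1 h2 => by simp [hz k h1 h2],
      sum_Icc_eq_sum_range hm1 _ fun k h1 h2 => by simp [hz k h1 h2],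
      sum_Icc_eq_sum_range hm1 _ fun k h1 h2 => by simp [hz k h1 h2]]
    push_cast
    congr 4
    · refine Finset.sum_congr rfl fun j _ => ?_
      field_simp
      ring
    · congr 1
      refine Finset.sum_congr rfl fun j _ => ?_
      rw [one_sub_div (by positivity), add_sub_cancel_right]
    · simp
  · ext s
    rw [Set.mem_ofPred_eq, hx, hy]
    exact ⟨hmem s, fun hs => hre s hs x0⟩

end
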